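/- Let c : I → ℝ² be a real-analytic non-degenerate plane curve parametrized by affine arclength, with affine curvature κ, and fix p ∈ I. Then the gravity curve γ_p of c at p is a straight line if and only if κ(p − s) = κ(p + s) for all sufficiently small s ∈ ℝ. -/

import Mathlib

open Set

noncomputable section

/-- The determinant `det(u,v) = u₁v₂ − u₂v₁` of two vectors of `ℝ²`. -/
def det2 (u v : ℝ × ℝ) : ℝ := u.1 * v.2 - u.2 * v.1

/-- `IsGravityCurve c I p ε γ`: `γ` is the gravity curve of the curve `c` (defined
on `I`) at `p`, on the parameter range `[0, ε)`.  This encodes: `γ 0 = c p`, and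
there are a neighborhood `J ⊆ I` of `p` and functions `s₋, s₊` such that for every
`δ ∈ (0, ε)` the translated tangent line `ℓ_δ = {c p + δ·c''(p) + t·c'(p)}` meets
`c(J)` exactly in the two points `c (s₋ δ)`, `c (s₊ δ)` with `s₋ δ < p < s₊ δ`,
and `γ δ` is the midpoint of these two points. -/
def IsGravityCurve (c : ℝ → ℝ × ℝ) (I : Set ℝ) (p : ℝ) (ε : ℝ) (γ : ℝ → ℝ × ℝ) :
    Prop :=
  0 < ε ∧ γ 0 = c p ∧
  ∃ J : Set ℝ, J ⊆ I ∧ IsOpen J ∧ p ∈ J ∧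
    ∃ sm sp : ℝ → ℝ, ∀ δ ∈ Set.Ioo 0 ε,
      sm δ ∈ J ∧ sp δ ∈ J ∧ sm δ < p ∧ p < sp δ ∧
      (∀ s ∈ J,
        (det2 (c s - (c p + δ • iteratedDeriv 2 c p)) (iteratedDeriv 1 c p) = 0 ↔
          s = sm δ ∨ s = sp δ)) ∧
      γ δ = (2⁻¹ : ℝ) • (c (sm δ) + c (sp δ))

/-- The gravity curve `γ` (with parameter range `[0, ε)`) is a straight line:
locally near `δ = 0` its image is contained in an affine line of `ℝ²`. -/
def IsStraightLine (γ : ℝ → ℝ × ℝ) (ε : ℝ) : Prop :=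
  ∃ ε₀ : ℝ, 0 < ε₀ ∧ ε₀ ≤ ε ∧ ∃ x v : ℝ × ℝ, v ≠ 0 ∧
    ∀ δ ∈ Set.Ico (0 : ℝ) ε₀, ∃ t : ℝ, γ δ = x + t • v

/-- A function with vanishing derivative on `(-r, r)` is constant there. -/
lemma eq_zero_value_of_hasDerivAt_zero {f : ℝ → ℝ} {r : ℝ}
    (hf : ∀ s, |s| < r → HasDerivAt f 0 s) {s : ℝ} (hs : |s| < r) : f s = f 0 := by
  have h0 : |(0 : ℝ)| < r := by simpa using (abs_nonneg s).trans_lt hs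
  refine isOpen_Ioo.is_const_of_deriv_eq_zero (s := Ioo (-r) r) isPreconnected_Ioo
    (fun x hx => (hf x (abs_lt.2 hx)).differentiableAt.differentiableWithinAt)
    (fun x hx => (hf x (abs_lt.2 hx)).deriv) (abs_lt.1 hs) (abs_lt.1 h0)

lemma hasDerivAt_comp_neg {f f' : ℝ → ℝ} {s : ℝ} (hf : HasDerivAt f (f' (-s)) (-s)) :
    HasDerivAt (fun t => f (-t)) (-f' (-s)) s := by
  exact (hf.scomp s (hasDerivAt_neg s)).congr_deriv (by simp)

/-- If `f` has parity `σ` near `0`, its derivative has parity `-σ`. -/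
lemma deriv_parity {f f' : ℝ → ℝ} {r σ : ℝ} (hf : ∀ s, |s| < r → HasDerivAt f (f' s) s)
    (h : ∀ s, |s| < r → f (-s) = σ * f s) {s : ℝ} (hs : |s| < r) :
    f' (-s) = -σ * f' s := by
  have h1 := hasDerivAt_comp_neg (hf (-s) (by rwa [abs_neg]))
  have h2 : HasDerivAt (fun t => f (-t)) (σ * f' s) s := by
    refine ((hf s hs).const_mul σ).congr_of_eventuallyEq ?_
    filter_upwards [(isOpen_lt continuous_abs continuous_const).mem_nhds hs] with t ht
    exact h t ht
  linarith [h1.unique h2]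

/-- If `f'` has parity `-σ` near `0`, then `f` has parity `σ` as soon as this holds at `0`. -/
lemma parity_of_deriv {f f' : ℝ → ℝ} {r σ : ℝ} (hf : ∀ s, |s| < r → HasDerivAt f (f' s) s)
    (h : ∀ s, |s| < r → f' (-s) = -σ * f' s) (h0 : f 0 = σ * f 0) {s : ℝ} (hs : |s| < r) :
    f (-s) = σ * f s := by
  have key := eq_zero_value_of_hasDerivAt_zero (f := fun t => f (-t) - σ * f t) (r := r)
    (fun t ht => by
      refine ((hasDerivAt_comp_neg (hf (-t) (by rwa [abs_neg]))).sub
        ((hf t ht).const_mul σ)).congr_deriv ?_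
      rw [h t ht]; ring) hs
  simp only [neg_zero] at key
  linarith

lemma pos_of_hasDerivAt_pos {f f' : ℝ → ℝ} {r : ℝ} (hf : ∀ s, |s| < r → HasDerivAt f (f' s) s)
    (h0 : f 0 = 0) (hpos : ∀ s, 0 < s → s < r → 0 < f' s) {s : ℝ} (hs : 0 < s) (hsr : s < r) :
    0 < f s := by
  have hd : ∀ x, 0 ≤ x → x ≤ s → HasDerivAt f (f' x) x := fun x h1 h2 =>
    hf x (by rw [abs_of_nonneg h1]; linarith)
  obtain ⟨x, hx, hx'⟩ := exists_hasDerivAt_eq_slope f f' hs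
    (fun x hx => (hd x hx.1 hx.2).continuousAt.continuousWithinAt)
    (fun x hx => hd x hx.1.le hx.2.le)
  have := hpos x hx.1 (hx.2.trans hsr)
  rw [hx', h0, sub_zero, sub_zero] at this
  exact (div_pos_iff_of_pos_right hs).1 this

/-- A function vanishing to second order at `0` with positive second derivative is positive
off `0`. -/
lemma pos_of_second_deriv_pos {y y₁ y₂ : ℝ → ℝ} {r : ℝ}
    (hy : ∀ s, |s| < r → HasDerivAt y (y₁ s) s) (hy₁ : ∀ s, |s| < r → HasDerivAt y₁ (y₂ s) s)
    (h0 : y 0 = 0) (h1 : y₁ 0 = 0) (hpos : ∀ s, |s| < r → 0 < y₂ s)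
    {s : ℝ} (hs : s ≠ 0) (hsr : |s| < r) : 0 < y s := by
  have aux : ∀ {z z₁ z₂ : ℝ → ℝ}, (∀ s, |s| < r → HasDerivAt z (z₁ s) s) →
      (∀ s, |s| < r → HasDerivAt z₁ (z₂ s) s) → z 0 = 0 → z₁ 0 = 0 →
      (∀ s, |s| < r → 0 < z₂ s) → ∀ s, 0 < s → s < r → 0 < z s :=
    fun hz hz₁ h0 h1 hp s h h' => pos_of_hasDerivAt_pos hz h0
      (fun t ht htr => pos_of_hasDerivAt_pos hz₁ h1
        (fun x hx hxr => hp x (by rwa [abs_of_pos hx])) ht htr) h h'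
  rcases lt_or_gt_of_ne hs with h | h
  · have := aux (z := fun t => y (-t)) (z₁ := fun t => -y₁ (-t)) (z₂ := fun t => y₂ (-t))
      (fun t ht => hasDerivAt_comp_neg (hy (-t) (by rwa [abs_neg])))
      (fun t ht => by
        exact (hasDerivAt_comp_neg (hy₁ (-t) (by rwa [abs_neg]))).fun_neg.congr_deriv
          (neg_neg _))
      (by simpa using h0) (by simpa using h1) (fun t ht => hpos _ (by rwa [abs_neg]))
      (-s) (by linarith) (by rwa [← abs_of_neg h])
    simpa using this
  · exact aux hy hy₁ h0 h1 hpos s h (by rwa [← abs_of_pos h])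

/-- Small positive levels of a function with a nondegenerate minimum at `0` are attained on
both sides, near `0`. -/
lemma exists_level_near_zero {y y₁ y₂ : ℝ → ℝ} {r : ℝ}
    (hy : ∀ s, |s| < r → HasDerivAt y (y₁ s) s) (hy₁ : ∀ s, |s| < r → HasDerivAt y₁ (y₂ s) s)
    (h0 : y 0 = 0) (h1 : y₁ 0 = 0) (hpos : ∀ s, |s| < r → 0 < y₂ s)
    {η : ℝ} (hη : 0 < η) (hηr : η < r) :
    ∃ δ₀ > 0, ∀ δ, 0 < δ → δ < δ₀ →
      (∃ s, 0 < s ∧ s < η ∧ y s = δ) ∧ (∃ s, -η < s ∧ s < 0 ∧ y s = δ) := by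
  have hc : ∀ s, |s| < r → ContinuousAt y s := fun s hs => (hy s hs).continuousAt
  have hp : ∀ s, s ≠ 0 → |s| < r → 0 < y s :=
    fun s hs hsr => pos_of_second_deriv_pos hy hy₁ h0 h1 hpos hs hsr
  refine ⟨min (y η) (y (-η)), lt_min (hp _ hη.ne' (by rwa [abs_of_pos hη]))
    (hp _ (by linarith) (by rwa [abs_neg, abs_of_pos hη])), fun δ hδ hδ' => ⟨?_, ?_⟩⟩
  · obtain ⟨s, hs, hs'⟩ := intermediate_value_Ioo hη.le
      (fun x hx => (hc x (by rw [abs_lt]; constructor <;> linarith [hx.1, hx.2])).continuousWithinAt)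
      (show δ ∈ Ioo (y 0) (y η) from ⟨by rwa [h0], hδ'.trans_le (min_le_left _ _)⟩)
    exact ⟨s, hs.1, hs.2, hs'⟩
  · obtain ⟨s, hs, hs'⟩ := intermediate_value_Ioo' (show -η ≤ 0 by linarith)
      (fun x hx => (hc x (by rw [abs_lt]; constructor <;> linarith [hx.1, hx.2])).continuousWithinAt)
      (show δ ∈ Ioo (y 0) (y (-η)) from ⟨by rwa [h0], hδ'.trans_le (min_le_right _ _)⟩)
    exact ⟨s, hs.1, hs.2, hs'⟩

/-- Solutions of `X'' = -k X` with `k` even: the cosine-like solution is even and the sine-like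
one is odd; this is stated for their primitives `x`, `y`. -/
lemma parity_of_even_curvature {x x₁ x₂ y y₁ y₂ k : ℝ → ℝ} {r : ℝ}
    (hx : ∀ s, |s| < r → HasDerivAt x (x₁ s) s)
    (hx₁ : ∀ s, |s| < r → HasDerivAt x₁ (x₂ s) s)
    (hx₂ : ∀ s, |s| < r → HasDerivAt x₂ (-k s * x₁ s) s)
    (hy : ∀ s, |s| < r → HasDerivAt y (y₁ s) s)
    (hy₁ : ∀ s, |s| < r → HasDerivAt y₁ (y₂ s) s)
    (hy₂ : ∀ s, |s| < r → HasDerivAt y₂ (-k s * y₁ s) s)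
    (x0 : x 0 = 0) (x10 : x₁ 0 = 1) (x20 : x₂ 0 = 0) (y10 : y₁ 0 = 0) (y20 : y₂ 0 = 1)
    (hW : ∀ s, |s| < r → x₁ s * y₂ s - x₂ s * y₁ s = 1)
    (hk : ∀ s, |s| < r → k (-s) = k s) :
    ∀ s, |s| < r → x (-s) = -x s ∧ y (-s) = y s := by
  have hn : ∀ s, |s| < r → |-s| < r := fun s hs => by rwa [abs_neg]
  have wr : ∀ {a a' b b' : ℝ → ℝ}, (∀ s, |s| < r → HasDerivAt a (a' s) s) →
      (∀ s, |s| < r → HasDerivAt a' (-k s * a s) s) →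
      (∀ s, |s| < r → HasDerivAt b (b' s) s) →
      (∀ s, |s| < r → HasDerivAt b' (-k s * b s) s) → ∀ s, |s| < r →
      a s * b' s - a' s * b s = a 0 * b' 0 - a' 0 * b 0 := by
    intro a a' b b' ha ha' hb hb' s hs
    refine eq_zero_value_of_hasDerivAt_zero (f := fun s => a s * b' s - a' s * b s) (r := r)
      (fun t ht => ?_) hs
    exact (((ha t ht).mul (hb' t ht)).sub ((ha' t ht).mul (hb t ht))).congr_deriv (by ring)
  have rv : ∀ {a a' : ℝ → ℝ}, (∀ s, |s| < r → HasDerivAt a (a' s) s) →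
      (∀ s, |s| < r → HasDerivAt a' (-k s * a s) s) →
      (∀ s, |s| < r → HasDerivAt (fun t => a (-t)) (-a' (-s)) s) ∧
      (∀ s, |s| < r → HasDerivAt (fun t => -a' (-t)) (-k s * a (-s)) s) := by
    intro a a' ha ha'
    refine ⟨fun s hs => hasDerivAt_comp_neg (ha _ (hn s hs)), fun s hs => ?_⟩
    have := (hasDerivAt_comp_neg (f' := fun s => -k s * a s) (ha' _ (hn s hs))).fun_neg
    exact this.congr_deriv (by rw [hk s hs]; ring)
  have hX : ∀ s, |s| < r → x₁ (-s) = x₁ s := by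
    intro s hs
    have e1 := wr hx₁ hx₂ (rv hx₁ hx₂).1 (rv hx₁ hx₂).2 s hs
    have e2 := wr hy₁ hy₂ (rv hx₁ hx₂).1 (rv hx₁ hx₂).2 s hs
    simp only [x10, x20, y10, y20, neg_zero] at e1 e2
    linear_combination -(x₁ (-s)) * hW s hs + y₁ s * e1 - x₁ s * e2
  have hY : ∀ s, |s| < r → y₁ (-s) = -y₁ s := by
    intro s hs
    have e1 := wr hx₁ hx₂ (rv hy₁ hy₂).1 (rv hy₁ hy₂).2 s hs
    have e2 := wr hy₁ hy₂ (rv hy₁ hy₂).1 (rv hy₁ hy₂).2 s hs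
    simp only [x10, x20, y10, y20, neg_zero] at e1 e2
    linear_combination -(y₁ (-s)) * hW s hs + y₁ s * e1 - x₁ s * e2
  intro s hs
  have h1 := parity_of_deriv (σ := -1) hx (fun t ht => by rw [hX t ht]; ring)
    (by rw [x0]; ring) hs
  have h2 := parity_of_deriv (σ := 1) hy (fun t ht => by rw [hY t ht]; ring) (by ring) hs
  exact ⟨by linarith, by linarith⟩

/-- If the graph function `y ∘ u⁻¹` is even on one side and `(u, y)` is parametrized by affine
arclength, then `u` is odd near `0`. -/
lemma odd_of_even_graph {u u₁ u₂ y y₁ y₂ : ℝ → ℝ} {r : ℝ} (hr : 0 < r)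
    (hu : ∀ s, |s| < r → HasDerivAt u (u₁ s) s)
    (hu₁ : ∀ s, |s| < r → HasDerivAt u₁ (u₂ s) s)
    (hy : ∀ s, |s| < r → HasDerivAt y (y₁ s) s)
    (hy₁ : ∀ s, |s| < r → HasDerivAt y₁ (y₂ s) s)
    (u0 : u 0 = 0) (hpos : ∀ s, |s| < r → 0 < u₁ s)
    (hW : ∀ s, |s| < r → u₁ s * y₂ s - u₂ s * y₁ s = 1)
    (hsymm : ∀ s s', |s| < r → |s'| < r → 0 < s → s' < 0 → u s' = -u s → y s' = y s) :
    ∃ ρ > 0, ρ ≤ r ∧ ∀ s, |s| < ρ → u (-s) = -u s := by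
  have nhd : ∀ {t : ℝ}, 0 < t → ∀ᶠ s : ℝ in nhds 0, |s| < t := fun {t} ht =>
    (isOpen_lt continuous_abs continuous_const).mem_nhds (by simpa using ht)
  have h0r : |(0 : ℝ)| < r := by simpa
  have hst : HasStrictDerivAt u (u₁ 0) 0 :=
    hasStrictDerivAt_of_hasDerivAt_of_continuousAt ((nhd hr).mono hu) (hu₁ 0 h0r).continuousAt
  have hst' := hst.hasStrictFDerivAt_equiv (hpos 0 h0r).ne'
  let e := hst'.toOpenPartialHomeomorph u
  have he : (e : ℝ → ℝ) = u := hst'.toOpenPartialHomeomorph_coe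
  have hmem : (0 : ℝ) ∈ e.source := hst'.mem_toOpenPartialHomeomorph_source
  have hmem' : (0 : ℝ) ∈ e.target := by
    have := e.map_source hmem
    rwa [he, u0] at this
  let g : ℝ → ℝ := e.symm
  have g0 : g 0 = 0 := by
    have := e.left_inv hmem
    rwa [he, u0] at this
  have hgc : ContinuousAt g 0 := e.symm.continuousAt hmem'
  have hgr : ∀ᶠ w in nhds 0, |g w| < r := by
    have := hgc.eventually (p := fun t => |t| < r) (by rw [g0]; exact nhd hr)
    exact this
  obtain ⟨ρ, hρ, hball⟩ := Metric.eventually_nhds_iff.1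
    (hgr.and (e.open_target.mem_nhds hmem'))
  have hg : ∀ w, |w| < ρ → |g w| < r ∧ w ∈ e.target := fun w hw =>
    hball (by simpa [Real.dist_eq] using hw)
  have hn : ∀ w, |w| < ρ → |-w| < ρ := fun w hw => by rwa [abs_neg]
  have hug : ∀ w, |w| < ρ → u (g w) = w := fun w hw => by
    have := e.right_inv (hg w hw).2
    rwa [he] at this
  have hgd : ∀ w, |w| < ρ → HasDerivAt g ((fun w => (u₁ (g w))⁻¹) w) w := fun w hw =>
    e.hasDerivAt_symm (hg w hw).2 (hpos _ (hg w hw).1).ne' (by rw [he]; exact hu _ (hg w hw).1)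
  have hmono : StrictMonoOn u (Ioo (-r) r) :=
    strictMonoOn_of_deriv_pos (convex_Ioo _ _)
      (fun s hs => (hu s (abs_lt.2 hs)).continuousAt.continuousWithinAt)
      (fun s hs => by
        rw [interior_Ioo] at hs
        rw [(hu s (abs_lt.2 hs)).deriv]; exact hpos s (abs_lt.2 hs))
  have hlt : ∀ a b, |a| < ρ → |b| < ρ → a < b → g a < g b := fun a b ha hb hab => by
    refine (hmono.lt_iff_lt (abs_lt.1 (hg a ha).1) (abs_lt.1 (hg b hb).1)).1 ?_
    rwa [hug a ha, hug b hb]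
  have h0ρ : |(0 : ℝ)| < ρ := by simpa
  have hpar : ∀ w, 0 < w → |w| < ρ → y (g (-w)) = y (g w) := fun w hw0 hw => by
    refine hsymm _ _ (hg w hw).1 (hg _ (hn w hw)).1 ?_ ?_ (by rw [hug w hw, hug _ (hn w hw)])
    · simpa [g0] using hlt 0 w h0ρ hw hw0
    · simpa [g0] using hlt (-w) 0 (hn w hw) h0ρ (by linarith)
  have hf : ∀ w, |w| < ρ → y (g (-w)) = 1 * y (g w) := fun w hw => by
    rw [one_mul]
    rcases lt_trichotomy w 0 with h | h | h
    · simpa using (hpar (-w) (by linarith) (hn w hw)).symm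
    · simp [h]
    · exact hpar w h hw
  have hfd : ∀ w, |w| < ρ →
      HasDerivAt (fun w => y (g w)) ((fun w => y₁ (g w) * (u₁ (g w))⁻¹) w) w :=
    fun w hw => (hy _ (hg w hw).1).comp w (hgd w hw)
  have hfd' : ∀ w, |w| < ρ → HasDerivAt (fun w => y₁ (g w) * (u₁ (g w))⁻¹)
      ((fun w => (u₁ (g w))⁻¹ ^ 3) w) w := fun w hw => by
    have hne := (hpos _ (hg w hw).1).ne'
    have h1 := (hy₁ _ (hg w hw).1).comp w (hgd w hw)
    have h2 := ((hu₁ _ (hg w hw).1).comp w (hgd w hw)).inv hne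
    refine (h1.mul h2).congr_deriv ?_
    simp only [Function.comp, Pi.inv_apply]
    field_simp
    linear_combination hW _ (hg w hw).1
  have hpar1 := fun w (hw : |w| < ρ) => deriv_parity hfd hf hw
  have hpar2 := fun w (hw : |w| < ρ) => deriv_parity hfd' hpar1 hw
  have hpar3 : ∀ w, |w| < ρ → (u₁ (g (-w)))⁻¹ = -(-1) * (u₁ (g w))⁻¹ := fun w hw => by
    have := hpar2 w hw
    simp only [neg_neg, one_mul] at this ⊢
    exact (pow_left_inj₀ (inv_nonneg.2 (hpos _ (hg _ (hn w hw)).1).le)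
      (inv_nonneg.2 (hpos _ (hg w hw).1).le) (by norm_num)).1 this
  have hgodd : ∀ w, |w| < ρ → g (-w) = -1 * g w := fun w hw =>
    parity_of_deriv hgd hpar3 (by rw [g0]; ring) hw
  have hev : ∀ᶠ s in nhds 0, |u s| < ρ ∧ s ∈ e.source := by
    refine Filter.Eventually.and ?_ (e.open_source.mem_nhds hmem)
    exact (hu 0 h0r).continuousAt.eventually (p := fun t => |t| < ρ) (by rw [u0]; exact nhd hρ)
  obtain ⟨ρ', hρ', hball'⟩ := Metric.eventually_nhds_iff.1 hev
  refine ⟨min ρ' r, lt_min hρ' hr, min_le_right _ _, fun s hs => ?_⟩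
  obtain ⟨h1, h2⟩ := hball' (y := s) (by simpa [Real.dist_eq] using hs.trans_le (min_le_left _ _))
  have h3 : g (u s) = s := by
    have := e.left_inv h2
    rwa [he] at this
  have h4 := hgodd _ h1
  rw [h3, neg_one_mul] at h4
  rw [← h4, hug _ (hn _ h1)]

/-- If `u` is odd near `0` with `u''' = -k u'` and `u' > 0`, then `k` is even near `0`. -/
lemma even_curvature_of_odd {u u₁ u₂ k : ℝ → ℝ} {r : ℝ}
    (hu : ∀ s, |s| < r → HasDerivAt u (u₁ s) s)
    (hu₁ : ∀ s, |s| < r → HasDerivAt u₁ (u₂ s) s)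
    (hu₂ : ∀ s, |s| < r → HasDerivAt u₂ (-k s * u₁ s) s)
    (hpos : ∀ s, |s| < r → 0 < u₁ s) (hodd : ∀ s, |s| < r → u (-s) = -u s)
    {s : ℝ} (hs : |s| < r) : k (-s) = k s := by
  have h1 := fun t (ht : |t| < r) =>
    deriv_parity (σ := -1) hu (fun t ht => by rw [hodd t ht]; ring) ht
  have h2 := fun t (ht : |t| < r) => deriv_parity hu₁ h1 ht
  have h3 := deriv_parity (f' := fun s => -k s * u₁ s) hu₂ h2 hs
  have h4 := h1 s hs
  simp only [neg_neg, one_mul] at h3 h4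
  rw [h4] at h3
  have := mul_right_cancel₀ (hpos s hs).ne' h3
  linarith

/-- Scalar form of one direction: even curvature makes the chords parallel to the tangent
have their midpoints on the affine normal. -/
lemma chord_sum_eq_zero_of_even_curvature {x x₁ x₂ y y₁ y₂ k m n : ℝ → ℝ} {r ε : ℝ}
    (hr : 0 < r) (hε : 0 < ε)
    (hx : ∀ s, |s| < r → HasDerivAt x (x₁ s) s)
    (hx₁ : ∀ s, |s| < r → HasDerivAt x₁ (x₂ s) s)
    (hx₂ : ∀ s, |s| < r → HasDerivAt x₂ (-k s * x₁ s) s)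
    (hy : ∀ s, |s| < r → HasDerivAt y (y₁ s) s)
    (hy₁ : ∀ s, |s| < r → HasDerivAt y₁ (y₂ s) s)
    (hy₂ : ∀ s, |s| < r → HasDerivAt y₂ (-k s * y₁ s) s)
    (x0 : x 0 = 0) (x10 : x₁ 0 = 1) (x20 : x₂ 0 = 0)
    (y0 : y 0 = 0) (y10 : y₁ 0 = 0) (y20 : y₂ 0 = 1)
    (hpos : ∀ s, |s| < r → 0 < y₂ s)
    (hW : ∀ s, |s| < r → x₁ s * y₂ s - x₂ s * y₁ s = 1)
    (hmn : ∀ δ ∈ Ioo 0 ε, m δ < 0 ∧ 0 < n δ ∧ ∀ s, |s| < r → (y s = δ ↔ s = m δ ∨ s = n δ))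
    (hk : ∀ s, |s| < r → k (-s) = k s) :
    ∃ ε₀ > 0, ε₀ ≤ ε ∧ ∀ δ ∈ Ioo 0 ε₀, x (m δ) + x (n δ) = 0 := by
  obtain ⟨δ₀, hδ₀, hlev⟩ := exists_level_near_zero hy hy₁ y0 y10 hpos (half_pos hr) (half_lt_self hr)
  refine ⟨min δ₀ ε, lt_min hδ₀ hε, min_le_right _ _, fun δ hδ => ?_⟩
  obtain ⟨hm, hn, hiff⟩ := hmn δ ⟨hδ.1, hδ.2.trans_le (min_le_right _ _)⟩
  obtain ⟨s, hs0, hsr, hys⟩ := (hlev δ hδ.1 (hδ.2.trans_le (min_le_left _ _))).1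
  have hs : |s| < r := by rw [abs_of_pos hs0]; linarith
  obtain ⟨hodd, heven⟩ := parity_of_even_curvature hx hx₁ hx₂ hy hy₁ hy₂ x0 x10 x20 y10 y20 hW hk s hs
  have h1 : s = n δ := ((hiff s hs).1 hys).resolve_left (by linarith)
  have h2 : -s = m δ :=
    ((hiff (-s) (by rwa [abs_neg])).1 (heven.trans hys)).resolve_right (by linarith)
  rw [← h1, ← h2, hodd]; ring

/-- Scalar form of the other direction: if the midpoints of the chords parallel to the tangent
lie on a line transverse to the tangent, the curvature is even. -/
lemma even_curvature_of_chord_sum {x x₁ x₂ y y₁ y₂ k m n : ℝ → ℝ} {r ε a : ℝ}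
    (hr : 0 < r) (hε : 0 < ε)
    (hx : ∀ s, |s| < r → HasDerivAt x (x₁ s) s)
    (hx₁ : ∀ s, |s| < r → HasDerivAt x₁ (x₂ s) s)
    (hx₂ : ∀ s, |s| < r → HasDerivAt x₂ (-k s * x₁ s) s)
    (hy : ∀ s, |s| < r → HasDerivAt y (y₁ s) s)
    (hy₁ : ∀ s, |s| < r → HasDerivAt y₁ (y₂ s) s)
    (hy₂ : ∀ s, |s| < r → HasDerivAt y₂ (-k s * y₁ s) s)
    (x0 : x 0 = 0) (x10 : x₁ 0 = 1) (y0 : y 0 = 0) (y10 : y₁ 0 = 0)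
    (hpos : ∀ s, |s| < r → 0 < y₂ s)
    (hW : ∀ s, |s| < r → x₁ s * y₂ s - x₂ s * y₁ s = 1)
    (hmn : ∀ δ ∈ Ioo 0 ε, m δ < 0 ∧ 0 < n δ ∧ ∀ s, |s| < r → (y s = δ ↔ s = m δ ∨ s = n δ))
    (ha : ∀ δ ∈ Ioo 0 ε, x (m δ) + x (n δ) = 2 * a * δ) :
    ∃ ρ > 0, ∀ s, |s| < ρ → k (-s) = k s := by
  have h0r : |(0 : ℝ)| < r := by simpa
  have hu : ∀ s, |s| < r → HasDerivAt (fun s => x s - a * y s) (x₁ s - a * y₁ s) s :=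
    fun s hs => (hx s hs).sub ((hy s hs).const_mul a)
  have hu₁ : ∀ s, |s| < r → HasDerivAt (fun s => x₁ s - a * y₁ s) (x₂ s - a * y₂ s) s :=
    fun s hs => (hx₁ s hs).sub ((hy₁ s hs).const_mul a)
  have hu₂ : ∀ s, |s| < r →
      HasDerivAt (fun s => x₂ s - a * y₂ s) (-k s * (x₁ s - a * y₁ s)) s :=
    fun s hs => ((hx₂ s hs).sub ((hy₂ s hs).const_mul a)).congr_deriv (by ring)
  obtain ⟨r₁, hr₁, hball₁⟩ := Metric.eventually_nhds_iff.1
    ((hu₁ 0 h0r).continuousAt.eventually (p := fun t => 0 < t)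
      (lt_mem_nhds (by simp [x10, y10])))
  have hr₂ : 0 < min r r₁ / 2 := half_pos (lt_min hr hr₁)
  have hr₂r : min r r₁ / 2 < r := by linarith [min_le_left r r₁]
  have hupos : ∀ s, |s| ≤ min r r₁ / 2 → 0 < x₁ s - a * y₁ s := fun s hs =>
    hball₁ (by rw [Real.dist_eq, sub_zero]; linarith [min_le_right r r₁])
  obtain ⟨δ₀, hδ₀, hlev⟩ := exists_level_near_zero hy hy₁ y0 y10 hpos hr₂ hr₂r
  obtain ⟨r₃, hr₃, hball₃⟩ := Metric.eventually_nhds_iff.1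
    ((hy 0 h0r).continuousAt.eventually (p := fun t => t < min δ₀ ε)
      (gt_mem_nhds (by rw [y0]; exact lt_min hδ₀ hε)))
  have hmono : StrictMonoOn (fun s => x s - a * y s) (Ioo (-(min r r₁ / 2)) (min r r₁ / 2)) :=
    strictMonoOn_of_deriv_pos (convex_Ioo _ _)
      (fun s hs => (hu s ((abs_lt.2 hs).trans hr₂r)).continuousAt.continuousWithinAt)
      (fun s hs => by
        rw [interior_Ioo] at hs
        rw [(hu s ((abs_lt.2 hs).trans hr₂r)).deriv]; exact hupos s (abs_lt.2 hs).le)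
  have hR : 0 < min (min r r₁ / 2) r₃ := lt_min hr₂ hr₃
  have hRr : ∀ s, |s| < min (min r r₁ / 2) r₃ → |s| < r :=
    fun s hs => (hs.trans_le (min_le_left _ _)).trans hr₂r
  have hRp : ∀ s, |s| < min (min r r₁ / 2) r₃ → 0 < x₁ s - a * y₁ s :=
    fun s hs => hupos s (hs.trans_le (min_le_left _ _)).le
  obtain ⟨ρ, hρ, hρR, hodd⟩ := odd_of_even_graph hR (fun s hs => hu s (hRr s hs))
    (fun s hs => hu₁ s (hRr s hs)) (fun s hs => hy s (hRr s hs)) (fun s hs => hy₁ s (hRr s hs))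
    (by simp [x0, y0]) hRp (fun s hs => by linear_combination hW s (hRr s hs)) (by
      intro s s' hs hs' hs0 hs0' huu
      have hyδ : y s < min δ₀ ε :=
        hball₃ (by rw [Real.dist_eq, sub_zero]; exact hs.trans_le (min_le_right _ _))
      have hy0 : 0 < y s := pos_of_second_deriv_pos hy hy₁ y0 y10 hpos hs0.ne' (hRr s hs)
      have hδ : y s ∈ Ioo 0 ε := ⟨hy0, hyδ.trans_le (min_le_right _ _)⟩
      obtain ⟨hm, hn, hiff⟩ := hmn _ hδ
      obtain ⟨t, ht, ht0, hyt⟩ := (hlev _ hy0 (hyδ.trans_le (min_le_left _ _))).2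
      have h1 : s = n (y s) := ((hiff s (hRr s hs)).1 rfl).resolve_left (by linarith)
      have htI : |t| < min r r₁ / 2 := abs_lt.2 ⟨ht, by linarith⟩
      have h2 : t = m (y s) := ((hiff t (htI.trans hr₂r)).1 hyt).resolve_right (by linarith)
      have h3 := ha _ hδ
      rw [← h1, ← h2] at h3
      have h4 : s' = t := hmono.injOn (abs_lt.1 (hs'.trans_le (min_le_left _ _))) (abs_lt.1 htI) (by
        rw [huu, hyt]; linarith)
      rw [h4, hyt])
  exact ⟨ρ, hρ, fun s hs => even_curvature_of_odd
    (fun s hs => hu s (hRr s (hs.trans_le hρR))) (fun s hs => hu₁ s (hRr s (hs.trans_le hρR)))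
    (fun s hs => hu₂ s (hRr s (hs.trans_le hρR))) (fun s hs => hRp s (hs.trans_le hρR)) hodd hs⟩

lemma hasDerivAt_det2_left {f : ℝ → ℝ × ℝ} {v : ℝ × ℝ} {p s : ℝ} (h : HasDerivAt f v (p + s))
    (w : ℝ × ℝ) : HasDerivAt (fun t => det2 (f (p + t)) w) (det2 v w) s := by
  have h1 := h.comp_const_add p s
  have hf : HasDerivAt (fun t => (f (p + t)).1) v.1 s :=
    (ContinuousLinearMap.fst ℝ ℝ ℝ).hasFDerivAt.comp_hasDerivAt s h1
  have hs : HasDerivAt (fun t => (f (p + t)).2) v.2 s :=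
    (ContinuousLinearMap.snd ℝ ℝ ℝ).hasFDerivAt.comp_hasDerivAt s h1
  exact (hf.mul_const w.2).sub (hs.mul_const w.1)

lemma det2_swap (u v : ℝ × ℝ) : det2 u v = -det2 v u := by
  simp only [det2]; ring

lemma hasDerivAt_det2_right {f : ℝ → ℝ × ℝ} {v : ℝ × ℝ} {p s : ℝ} (h : HasDerivAt f v (p + s))
    (w : ℝ × ℝ) : HasDerivAt (fun t => det2 w (f (p + t))) (det2 w v) s := by
  simpa only [det2_swap w] using (hasDerivAt_det2_left h w).fun_neg

/-- Cramer's rule for a unimodular pair of vectors. -/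
lemma eq_det2_smul_add {P Q : ℝ × ℝ} (h : det2 P Q = 1) (v : ℝ × ℝ) :
    v = det2 v Q • P + det2 P v • Q := by
  simp only [det2] at h ⊢
  ext
  · simp only [Prod.fst_add, Prod.smul_fst, smul_eq_mul]
    linear_combination -v.1 * h
  · simp only [Prod.snd_add, Prod.smul_snd, smul_eq_mul]
    linear_combination -v.2 * h

lemma hasDerivAt_iteratedDeriv {c : ℝ → ℝ × ℝ} {I : Set ℝ} (hc : AnalyticOnNhd ℝ c I) (k : ℕ)
    {s : ℝ} (hs : s ∈ I) : HasDerivAt (iteratedDeriv k c) (iteratedDeriv (k + 1) c s) s := by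
  have h := hc.iterated_deriv k s hs
  rw [← iteratedDeriv_eq_iterate] at h
  rw [iteratedDeriv_succ]
  exact h.differentiableAt.hasDerivAt

/-- for a real-analytic non-degenerate plane curve `c` parametrized
by affine arclength with affine curvature `κ`, the gravity curve of `c` at `p` is
a straight line if and only if `κ(p - s) = κ(p + s)` for all sufficiently
small `s`. -/
theorem stmt1 (I : Set ℝ) (hIo : IsOpen I) (hIc : I.OrdConnected)
    (c : ℝ → ℝ × ℝ) (hc : AnalyticOnNhd ℝ c I)
    (hdet : ∀ s ∈ I, det2 (iteratedDeriv 1 c s) (iteratedDeriv 2 c s) = 1)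
    (κ : ℝ → ℝ)
    (hκ : ∀ s ∈ I, iteratedDeriv 3 c s = -κ s • iteratedDeriv 1 c s)
    (p : ℝ) (hp : p ∈ I)
    (ε : ℝ) (γ : ℝ → ℝ × ℝ) (hγ : IsGravityCurve c I p ε γ) :
    IsStraightLine γ ε ↔
      ∃ ε' > (0 : ℝ), ∀ s : ℝ, |s| < ε' → κ (p - s) = κ (p + s) := by
  obtain ⟨hε, hγ0, J, hJI, hJo, hpJ, sm, sp, hJ⟩ := hγ
  obtain ⟨P, hP⟩ : ∃ P, P = iteratedDeriv 1 c p := ⟨_, rfl⟩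
  obtain ⟨Q, hQ⟩ : ∃ Q, Q = iteratedDeriv 2 c p := ⟨_, rfl⟩
  have hPQ : det2 P Q = 1 := by rw [hP, hQ]; exact hdet p hp
  have hself : ∀ v : ℝ × ℝ, det2 v v = 0 := fun v => by simp only [det2]; ring
  have hd := fun k {s} (hs : s ∈ I) => hasDerivAt_iteratedDeriv hc k hs
  have hd0 : ∀ s ∈ I, HasDerivAt (fun t => c t - c p) (iteratedDeriv 1 c s) s := fun s hs => by
    simpa using (hd 0 hs).sub_const (c p)
  have hd2 : ∀ s ∈ I, HasDerivAt (iteratedDeriv 2 c) (-κ s • iteratedDeriv 1 c s) s :=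
    fun s hs => by rw [← hκ s hs]; exact hd 2 hs
  obtain ⟨r, hr, hrJ, hpos⟩ : ∃ r > 0, (∀ s, |s| < r → p + s ∈ J) ∧
      ∀ s, |s| < r → 0 < det2 P (iteratedDeriv 2 c (p + s)) := by
    have h1 : ∀ᶠ s in nhds (0 : ℝ), p + s ∈ J :=
      (continuous_const.add continuous_id).continuousAt.eventually
        (hJo.mem_nhds (by simpa using hpJ))
    have h2 : ∀ᶠ s in nhds (0 : ℝ), 0 < det2 P (iteratedDeriv 2 c (p + s)) :=
      (hasDerivAt_det2_right (s := 0) (hd2 (p + 0) (by simpa using hp)) P).continuousAt.eventually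
        (lt_mem_nhds (by beta_reduce; rw [add_zero, ← hQ, hPQ]; exact one_pos))
    obtain ⟨r, hr, h⟩ := Metric.eventually_nhds_iff.1 (h1.and h2)
    exact ⟨r, hr, fun s hs => (h (by simpa [Real.dist_eq] using hs)).1,
      fun s hs => (h (by simpa [Real.dist_eq] using hs)).2⟩
  have hrI : ∀ s, |s| < r → p + s ∈ I := fun s hs => hJI (hrJ s hs)
  have hx := fun s (hs : |s| < r) => hasDerivAt_det2_left (hd0 _ (hrI s hs)) Q
  have hx₁ := fun s (hs : |s| < r) => hasDerivAt_det2_left (hd 1 (hrI s hs)) Q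
  have smul_left : ∀ (a : ℝ) (v w : ℝ × ℝ), det2 (a • v) w = a * det2 v w := fun a v w => by
    simp only [det2, Prod.smul_fst, Prod.smul_snd, smul_eq_mul]; ring
  have smul_right : ∀ (a : ℝ) (v w : ℝ × ℝ), det2 v (a • w) = a * det2 v w := fun a v w => by
    simp only [det2, Prod.smul_fst, Prod.smul_snd, smul_eq_mul]; ring
  have hx₂ := fun s (hs : |s| < r) =>
    (hasDerivAt_det2_left (hd2 _ (hrI s hs)) Q).congr_deriv (smul_left _ _ _)
  have hy := fun s (hs : |s| < r) => hasDerivAt_det2_right (hd0 _ (hrI s hs)) P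
  have hy₁ := fun s (hs : |s| < r) => hasDerivAt_det2_right (hd 1 (hrI s hs)) P
  have hy₂ := fun s (hs : |s| < r) =>
    (hasDerivAt_det2_right (hd2 _ (hrI s hs)) P).congr_deriv (smul_right _ _ _)
  have hW : ∀ s, |s| < r → det2 (iteratedDeriv 1 c (p + s)) Q * det2 P (iteratedDeriv 2 c (p + s))
      - det2 (iteratedDeriv 2 c (p + s)) Q * det2 P (iteratedDeriv 1 c (p + s)) = 1 := by
    intro s hs
    have h1 := hdet _ (hrI s hs)
    simp only [det2] at h1 hPQ ⊢
    linear_combination h1 * (P.1 * Q.2 - P.2 * Q.1) + hPQ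
  have hline : ∀ δ s, det2 (c s - (c p + δ • Q)) P = 0 ↔ det2 P (c s - c p) = δ := by
    intro δ s
    have : det2 (c s - (c p + δ • Q)) P = δ * det2 P Q - det2 P (c s - c p) := by
      simp only [det2, Prod.fst_sub, Prod.snd_sub, Prod.fst_add, Prod.snd_add, Prod.smul_fst,
        Prod.smul_snd, smul_eq_mul]
      ring
    rw [this, hPQ, mul_one, sub_eq_zero, eq_comm]
  have hmn : ∀ δ ∈ Ioo 0 ε, sm δ - p < 0 ∧ 0 < sp δ - p ∧ ∀ s, |s| < r →
      (det2 P (c (p + s) - c p) = δ ↔ s = sm δ - p ∨ s = sp δ - p) := by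
    intro δ hδ
    obtain ⟨-, -, h1, h2, h3, -⟩ := hJ δ hδ
    refine ⟨by linarith, by linarith, fun s hs => ?_⟩
    have h4 := h3 _ (hrJ s hs)
    rw [← hP, ← hQ, hline] at h4
    rw [h4, eq_sub_iff_add_eq, eq_sub_iff_add_eq, add_comm]
  have hmid : ∀ δ ∈ Ioo 0 ε, γ δ - c p = (2⁻¹ * (det2 (c (p + (sm δ - p)) - c p) Q +
      det2 (c (p + (sp δ - p)) - c p) Q)) • P + δ • Q := by
    intro δ hδ
    obtain ⟨hm, hp', -, -, h3, h4⟩ := hJ δ hδ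
    have e1 := (h3 _ hm).2 (Or.inl rfl)
    have e2 := (h3 _ hp').2 (Or.inr rfl)
    rw [← hP, ← hQ, hline] at e1 e2
    rw [add_sub_cancel, add_sub_cancel]
    conv_lhs => rw [eq_det2_smul_add hPQ (γ δ - c p), h4]
    congr 2
    · simp only [det2, Prod.fst_sub, Prod.snd_sub, Prod.fst_add, Prod.snd_add, Prod.smul_fst,
        Prod.smul_snd, smul_eq_mul]
      ring
    · simp only [det2, Prod.fst_sub, Prod.snd_sub, Prod.fst_add, Prod.snd_add, Prod.smul_fst,
        Prod.smul_snd, smul_eq_mul] at e1 e2 ⊢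
      linear_combination (e1 + e2) / 2
  have x0 : det2 (c (p + 0) - c p) Q = 0 := by simp [det2]
  have x10 : det2 (iteratedDeriv 1 c (p + 0)) Q = 1 := by rw [add_zero, ← hP, hPQ]
  have x20 : det2 (iteratedDeriv 2 c (p + 0)) Q = 0 := by rw [add_zero, ← hQ, hself]
  have y0 : det2 P (c (p + 0) - c p) = 0 := by simp [det2]
  have y10 : det2 P (iteratedDeriv 1 c (p + 0)) = 0 := by rw [add_zero, ← hP, hself]
  have y20 : det2 P (iteratedDeriv 2 c (p + 0)) = 1 := by rw [add_zero, ← hQ, hPQ]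
  constructor
  · rintro ⟨ε₀, hε₀, hε₀ε, x, v, hv, hxv⟩
    obtain ⟨t₀, ht₀⟩ := hxv 0 ⟨le_rfl, hε₀⟩
    rw [hγ0] at ht₀
    have hcol : ∀ δ ∈ Ioo 0 ε₀, (2⁻¹ * (det2 (c (p + (sm δ - p)) - c p) Q +
        det2 (c (p + (sp δ - p)) - c p) Q)) * det2 P v = δ * det2 v Q := by
      intro δ hδ
      have h1 := hmid δ ⟨hδ.1, hδ.2.trans_le hε₀ε⟩
      obtain ⟨t, ht⟩ := hxv δ ⟨hδ.1.le, hδ.2⟩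
      have h2 : γ δ - c p = (t - t₀) • v := by rw [ht, ht₀, sub_smul]; abel
      rw [h2] at h1
      have h3 := congrArg (fun w => det2 w v) h1
      simp only [smul_left, hself, mul_zero] at h3
      simp only [det2, Prod.fst_add, Prod.snd_add, Prod.smul_fst,
        Prod.smul_snd, smul_eq_mul] at h3 ⊢
      linear_combination -h3
    have hβ : det2 P v ≠ 0 := by
      intro h0
      have h1 := hcol (ε₀ / 2) ⟨by linarith, by linarith⟩
      rw [h0, mul_zero] at h1
      have h2 : det2 v Q = 0 := by
        rcases mul_eq_zero.1 h1.symm with h | h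
        · linarith
        · exact h
      apply hv
      rw [eq_det2_smul_add hPQ v, h0, h2, zero_smul, zero_smul, add_zero]
    obtain ⟨ρ, hρ, hk⟩ := even_curvature_of_chord_sum (k := fun s => κ (p + s))
      (m := fun δ => sm δ - p) (n := fun δ => sp δ - p) (a := det2 v Q / det2 P v)
      hr hε₀ hx hx₁ hx₂ hy hy₁ hy₂ x0 x10 y0 y10 hpos hW
      (fun δ hδ => hmn δ ⟨hδ.1, hδ.2.trans_le hε₀ε⟩)
      (fun δ hδ => by
        have := hcol δ hδ
        field_simp
        linear_combination 2 * this)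
    exact ⟨ρ, hρ, fun s hs => by simpa [sub_eq_add_neg] using hk s hs⟩
  · rintro ⟨ε', hε', hk⟩
    have hle : ∀ s, |s| < min r ε' → |s| < r := fun s hs => hs.trans_le (min_le_left _ _)
    obtain ⟨ε₀, hε₀, hε₀ε, h0⟩ := chord_sum_eq_zero_of_even_curvature (k := fun s => κ (p + s))
      (m := fun δ => sm δ - p) (n := fun δ => sp δ - p) (lt_min hr hε') hε
      (fun s hs => hx s (hle s hs)) (fun s hs => hx₁ s (hle s hs)) (fun s hs => hx₂ s (hle s hs))
      (fun s hs => hy s (hle s hs)) (fun s hs => hy₁ s (hle s hs)) (fun s hs => hy₂ s (hle s hs))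
      x0 x10 x20 y0 y10 y20 (fun s hs => hpos s (hle s hs)) (fun s hs => hW s (hle s hs))
      (fun δ hδ => ⟨(hmn δ hδ).1, (hmn δ hδ).2.1, fun s hs => (hmn δ hδ).2.2 s (hle s hs)⟩)
      (fun s hs => by
        simpa [sub_eq_add_neg] using hk s (hs.trans_le (min_le_right _ _)))
    refine ⟨ε₀, hε₀, hε₀ε, c p, Q, ?_, fun δ hδ => ⟨δ, ?_⟩⟩
    · rintro rfl
      simp [det2] at hPQ
    · rcases hδ.1.eq_or_lt with rfl | h
      · rw [hγ0, zero_smul, add_zero]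
      · have h1 := hmid δ ⟨h, hδ.2.trans_le hε₀ε⟩
        have h2 := h0 δ ⟨h, hδ.2⟩
        rw [h2, mul_zero, zero_smul, zero_add] at h1
        rw [← h1]; abel

end
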